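/- Let U be a finite set and let μ, ν be probability distributions on subsets of U with supp(ν) ⊆ supp(μ). Let P_μ be an irreducible, aperiodic transition matrix on supp(μ) that is reversible with respect to μ, and let P_ν be any transition matrix on supp(ν) for which ν is stationary. Let f : 2^U → ℝ and let h(x) = ∑_{t=0}^∞ E[f(X_t) − E_μ f | X_0 = x] be the solution of the Poisson equation h − P_μ h = f − E_μ f. Then for any coupling of two faithful copies of P_μ and every S ∈ supp(ν): |(P_ν h)(S) − (P_μ h)(S)| ≤ ∑_{T≠S} |P_μ(S→T) − P_ν(S→T)| · ∑_{t=0}^∞ E[|f(X_t) − f(Y_t)| | X_0=S, Y_0=T]. -/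

import Mathlib

open Finset

attribute [local instance] Classical.propDecidable

/-- `μ` is a probability distribution on the finite type `Ω`. -/
def IsProbDist {Ω : Type*} [Fintype Ω] (μ : Ω → ℝ) : Prop :=
  (∀ x, 0 ≤ μ x) ∧ ∑ x, μ x = 1

/-- `P` is a row-stochastic transition matrix whose dynamics is supported on `Ω₀`
(transitions out of `Ω₀` are impossible, and off `Ω₀` the matrix is extended as the identity,
so that `P` together with its powers faithfully represents a Markov chain on state space `Ω₀`). -/
def IsTransOn {Ω : Type*} [Fintype Ω] [DecidableEq Ω] (P : Matrix Ω Ω ℝ) (Ω₀ : Set Ω) : Prop :=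
  (∀ x y, 0 ≤ P x y) ∧ (∀ x, ∑ y, P x y = 1) ∧
    (∀ x ∈ Ω₀, ∀ y, P x y ≠ 0 → y ∈ Ω₀) ∧
    (∀ x, x ∉ Ω₀ → ∀ y, P x y = if x = y then 1 else 0)

/-- `P` is reversible with respect to `π`. -/
def ReversibleWrt {Ω : Type*} (P : Matrix Ω Ω ℝ) (π : Ω → ℝ) : Prop :=
  ∀ x y, π x * P x y = π y * P y x

/-- `π` is stationary for `P`. -/
def StationaryWrt {Ω : Type*} [Fintype Ω] (P : Matrix Ω Ω ℝ) (π : Ω → ℝ) : Prop :=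
  ∀ y, ∑ x, π x * P x y = π y

/-- `P` is irreducible on the state space `Ω₀`. -/
def IrreducibleOn {Ω : Type*} [Fintype Ω] [DecidableEq Ω] (P : Matrix Ω Ω ℝ) (Ω₀ : Set Ω) : Prop :=
  ∀ x ∈ Ω₀, ∀ y ∈ Ω₀, ∃ t : ℕ, 0 < (P ^ t) x y

/-- `P` is aperiodic on the state space `Ω₀`: for every state, the gcd of the return
times is `1` (every common divisor of the return times equals `1`). -/
def AperiodicOn {Ω : Type*} [Fintype Ω] [DecidableEq Ω] (P : Matrix Ω Ω ℝ) (Ω₀ : Set Ω) : Prop :=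
  ∀ x ∈ Ω₀, ∀ d : ℕ, 0 < d → (∀ t : ℕ, 0 < t → 0 < (P ^ t) x x → d ∣ t) → d = 1

/-- A coupling of two faithful copies of the chain `P`, recorded through its time-`t` joint
distributions: `coup x y t a b` is the probability that `(X t, Y t) = (a, b)` given the starting
states `X 0 = x` and `Y 0 = y`; marginally each copy evolves according to `P`. -/
def IsCoupling {Ω : Type*} [Fintype Ω] [DecidableEq Ω] (P : Matrix Ω Ω ℝ)
    (coup : Ω → Ω → ℕ → Ω → Ω → ℝ) : Prop :=
  (∀ x y t a b, 0 ≤ coup x y t a b) ∧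
    (∀ x y t a, ∑ b, coup x y t a b = (P ^ t) x a) ∧
    (∀ x y t b, ∑ a, coup x y t a b = (P ^ t) y b)

/-- Hamming distance between two finite sets: the size of their symmetric difference. -/
def hamm {U : Type*} [DecidableEq U] (S T : Finset U) : ℕ := ((S \ T) ∪ (T \ S)).card

/-- `margOf μ j = Pr_{S ∼ μ}[j ∈ S]`. -/
def margOf {U : Type*} [Fintype U] [DecidableEq U] (μ : Finset U → ℝ) (j : U) : ℝ :=
  ∑ S : Finset U, if j ∈ S then μ S else 0

/-- `μ` conditioned on the event `{S : A ⊆ S}`. -/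
noncomputable def condOn {U : Type*} [Fintype U] [DecidableEq U] (μ : Finset U → ℝ)
    (A : Finset U) : Finset U → ℝ := fun S =>
  if A ⊆ S then μ S / ∑ T : Finset U, (if A ⊆ T then μ T else 0) else 0

/-- Junk-value-safe comparison of two series: no summability assumption is needed, because once
the right-hand side is finite the two series are either both summable or both of sum `0`. -/
theorem ofReal_abs_tsum_sub_tsum_le {u v c : ℕ → ℝ} (huv : ∀ t, |u t - v t| ≤ c t) :
    ENNReal.ofReal |(∑' t, u t) - ∑' t, v t| ≤ ∑' t, ENNReal.ofReal (c t) := by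
  by_cases htop : ∑' t, ENNReal.ofReal (c t) = ⊤
  · simp [htop]
  have hc0 : ∀ t, 0 ≤ c t := fun t => (abs_nonneg _).trans (huv t)
  have hc : Summable c := by
    simpa [ENNReal.toReal_ofReal, hc0] using ENNReal.summable_toReal htop
  have habs : Summable fun t => |u t - v t| := hc.of_nonneg_of_le (fun _ => abs_nonneg _) huv
  have hd : Summable fun t => u t - v t := habs.of_abs
  rw [← ENNReal.ofReal_tsum_of_nonneg hc0 hc]
  apply ENNReal.ofReal_le_ofReal
  by_cases hv : Summable v
  · have hu : Summable u := by simpa using hd.add hv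
    rw [← hu.tsum_sub hv]
    calc |∑' t, (u t - v t)| ≤ ∑' t, |u t - v t| := by
          simpa [Real.norm_eq_abs] using norm_tsum_le_tsum_norm (f := fun t => u t - v t) habs
      _ ≤ ∑' t, c t := habs.tsum_le_tsum huv hc
  · have hu : ¬ Summable u := fun hu => hv (by simpa using hu.sub hd)
    rw [tsum_eq_zero_of_not_summable hu, tsum_eq_zero_of_not_summable hv]
    simpa using tsum_nonneg hc0

/-- The expectations of `f` under two copies of a chain differ by at most the expected difference
under any coupling. -/
theorem IsCoupling.abs_sub_le {Ω : Type*} [Fintype Ω] [DecidableEq Ω] {P : Matrix Ω Ω ℝ}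
    {coup : Ω → Ω → ℕ → Ω → Ω → ℝ} (hcoup : IsCoupling P coup) (f : Ω → ℝ) (x y : Ω) (t : ℕ) :
    |(∑ a, (P ^ t) x a * f a) - ∑ b, (P ^ t) y b * f b| ≤
      ∑ a, ∑ b, coup x y t a b * |f a - f b| := by
  obtain ⟨hnn, hfst, hsnd⟩ := hcoup
  have hdiff : (∑ a, (P ^ t) x a * f a) - ∑ b, (P ^ t) y b * f b =
      ∑ a, ∑ b, coup x y t a b * (f a - f b) := by
    simp_rw [← hfst x y t, ← hsnd x y t, Finset.sum_mul, mul_sub, Finset.sum_sub_distrib]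
    congr 1
    exact Finset.sum_comm
  rw [hdiff]
  refine (Finset.abs_sum_le_sum_abs _ _).trans (Finset.sum_le_sum fun a _ => ?_)
  refine (Finset.abs_sum_le_sum_abs _ _).trans (Finset.sum_le_sum fun b _ => ?_)
  rw [abs_mul, abs_of_nonneg (hnn x y t a b)]

/-- entrywise bound on `(P_ν − P_μ)h` for the Poisson solution.
Let `μ, ν` be probability distributions on subsets of `U` with `supp ν ⊆ supp μ`, `Pμ` an
irreducible aperiodic transition matrix on `supp μ` reversible w.r.t. `μ`, `Pν` any transition
matrix on `supp ν` for which `ν` is stationary, `f : 2^U → ℝ`, and let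
`h x = ∑_{t=0}^∞ E[f(X_t) − E_μ f ∣ X_0 = x]` be the solution of the Poisson equation.
Then for any coupling of two faithful copies of `Pμ` and every `S ∈ supp ν`,
`|(Pν h)(S) − (Pμ h)(S)| ≤ ∑_{T≠S} |Pμ(S→T) − Pν(S→T)| · ∑_{t=0}^∞ E[|f(X_t) − f(Y_t)| ∣ X_0=S, Y_0=T]`. -/
theorem poisson_solution_entrywise_bound
    {U : Type*} [Fintype U] [DecidableEq U]
    (μ ν : Finset U → ℝ) (hμ : IsProbDist μ) (hν : IsProbDist ν)
    (hsupp : ∀ S, ν S ≠ 0 → μ S ≠ 0)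
    (Pμ Pν : Matrix (Finset U) (Finset U) ℝ)
    (hPμ : IsTransOn Pμ {S | μ S ≠ 0})
    (hirr : IrreducibleOn Pμ {S | μ S ≠ 0})
    (haper : AperiodicOn Pμ {S | μ S ≠ 0})
    (hrev : ReversibleWrt Pμ μ)
    (hPν : IsTransOn Pν {S | ν S ≠ 0})
    (hstat : StationaryWrt Pν ν)
    (f : Finset U → ℝ)
    (h : Finset U → ℝ)
    (hdef : ∀ x : Finset U,
      h x = ∑' t : ℕ, ((∑ y : Finset U, (Pμ ^ t) x y * f y) - ∑ y : Finset U, μ y * f y))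
    (coup : Finset U → Finset U → ℕ → Finset U → Finset U → ℝ)
    (hcoup : IsCoupling Pμ coup) :
    ∀ S : Finset U, ν S ≠ 0 →
      ENNReal.ofReal |(∑ T : Finset U, Pν S T * h T) - ∑ T : Finset U, Pμ S T * h T| ≤
        ∑ T ∈ Finset.univ.erase S, ENNReal.ofReal |Pμ S T - Pν S T| *
          ∑' t : ℕ, ENNReal.ofReal (∑ a : Finset U, ∑ b : Finset U,
            coup S T t a b * |f a - f b|) := by
  intro S _
  have hentry : ∀ T, ENNReal.ofReal |h T - h S| ≤ ∑' t : ℕ, ENNReal.ofReal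
      (∑ a : Finset U, ∑ b : Finset U, coup S T t a b * |f a - f b|) := fun T => by
    rw [abs_sub_comm, hdef S, hdef T]
    refine ofReal_abs_tsum_sub_tsum_le fun t => ?_
    rw [sub_sub_sub_cancel_right]
    exact hcoup.abs_sub_le f S T t
  have hrow : (∑ T, Pν S T * h T) - ∑ T, Pμ S T * h T =
      ∑ T ∈ Finset.univ.erase S, (Pν S T - Pμ S T) * (h T - h S) := by
    rw [Finset.sum_erase _ (by simp)]
    simp_rw [mul_sub, sub_mul, Finset.sum_sub_distrib, ← Finset.sum_mul, hPμ.2.1 S, hPν.2.1 S]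
    ring
  rw [hrow]
  calc ENNReal.ofReal |∑ T ∈ Finset.univ.erase S, (Pν S T - Pμ S T) * (h T - h S)|
      ≤ ENNReal.ofReal (∑ T ∈ Finset.univ.erase S, |Pμ S T - Pν S T| * |h T - h S|) := by
        refine ENNReal.ofReal_le_ofReal ((Finset.abs_sum_le_sum_abs _ _).trans_eq ?_)
        exact Finset.sum_congr rfl fun T _ => by rw [abs_mul, abs_sub_comm (Pν S T)]
    _ = ∑ T ∈ Finset.univ.erase S,
          ENNReal.ofReal |Pμ S T - Pν S T| * ENNReal.ofReal |h T - h S| := by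
        rw [ENNReal.ofReal_sum_of_nonneg fun T _ => by positivity]
        exact Finset.sum_congr rfl fun T _ => ENNReal.ofReal_mul (abs_nonneg _)
    _ ≤ _ := Finset.sum_le_sum fun T _ => by gcongr; exact hentry T
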